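/- Let N ≥ 1 and let Ω₁, Ω₂ ⊂ ℝ^N be nonempty bounded open connected sets with disjoint closures. Let μ⁻ be a finite nonnegative Borel measure on [0,1] with μ⁻((0,1)) > 0. For a nonempty open set U ⊂ ℝ^N define λ(U) := inf { (∫_U |∇u(x)|² dx) / (∫_{[0,1)} [u]_s² dμ⁻(s)) : u ∈ A(U), ∫_U |∇u|² dx < ∞, 0 < ∫_{[0,1)} [u]_s² dμ⁻(s) < ∞ }. Assume that for each j ∈ {1,2} there exists u_j ∈ A(Ω_j) with u_j ≥ 0, u_j not identically zero, ∫_{Ω_j} |∇u_j|² dx < ∞ and 0 < ∫_{[0,1)} [u_j]_s² dμ⁻(s) < ∞, whose quotient attains λ(Ω_j), i.e. (∫_{Ω_j}|∇u_j|²dx)/(∫_{[0,1)}[u_j]_s²dμ⁻(s)) = λ(Ω_j). Then λ(Ω₁ ∪ Ω₂) < min{λ(Ω₁), λ(Ω₂)}. -/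

import Mathlib

open MeasureTheory Filter Topology
open scoped ENNReal

noncomputable def cNs (N : ℕ) (s : ℝ) : ℝ :=
  (2 ^ (2 * s - 1) * Real.Gamma ((N + 2 * s) / 2) * (s * (1 - s))) /
    (Real.pi ^ ((N : ℝ) / 2) * Real.Gamma (2 - s))

/-- Squared Gagliardo seminorm `[u]_s²`, with the convention `[u]_0 = ‖u‖_{L²}`. -/
noncomputable def gagSq (N : ℕ) (u : EuclideanSpace ℝ (Fin N) → ℝ) (s : ℝ) : ℝ≥0∞ :=
  if s = 0 then ∫⁻ x, ENNReal.ofReal (u x ^ 2)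
  else ENNReal.ofReal (cNs N s) *
    ∫⁻ x, ∫⁻ y, ENNReal.ofReal ((u x - u y) ^ 2 / ‖x - y‖ ^ ((N : ℝ) + 2 * s))

/-- `A(U)`: continuous on `ℝ^N`, continuously differentiable on `U`, zero outside `U`. -/
def memA (N : ℕ) (U : Set (EuclideanSpace ℝ (Fin N))) (u : EuclideanSpace ℝ (Fin N) → ℝ) : Prop :=
  Continuous u ∧ ContDiffOn ℝ 1 u U ∧ ∀ x ∉ U, u x = 0

/-- The denominator `∫_{[0,1)} [u]_s² dμ⁻(s)`. -/
noncomputable def denom (N : ℕ) (μm : Measure ℝ) (u : EuclideanSpace ℝ (Fin N) → ℝ) : ℝ≥0∞ :=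
  ∫⁻ s in Set.Ico (0 : ℝ) 1, gagSq N u s ∂μm

/-- Admissibility for the Rayleigh quotient on `U`. -/
def admissible (N : ℕ) (μm : Measure ℝ) (U : Set (EuclideanSpace ℝ (Fin N)))
    (u : EuclideanSpace ℝ (Fin N) → ℝ) : Prop :=
  memA N U u ∧ IntegrableOn (fun x => ‖fderiv ℝ u x‖ ^ 2) U volume ∧
    0 < denom N μm u ∧ denom N μm u < ⊤

/-- The Rayleigh quotient. -/
noncomputable def rayleigh (N : ℕ) (μm : Measure ℝ) (U : Set (EuclideanSpace ℝ (Fin N)))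
    (u : EuclideanSpace ℝ (Fin N) → ℝ) : ℝ :=
  (∫ x in U, ‖fderiv ℝ u x‖ ^ 2) / (denom N μm u).toReal

/-- The first "eigenvalue" `λ(U)`. -/
noncomputable def lam (N : ℕ) (μm : Measure ℝ) (U : Set (EuclideanSpace ℝ (Fin N))) : ℝ :=
  sInf { r : ℝ | ∃ u, admissible N μm U u ∧ r = rayleigh N μm U u }

/-- The double integral of `f` against the Gagliardo kernel of order `s`. -/
noncomputable def kernelIntegral (N : ℕ)
    (f : EuclideanSpace ℝ (Fin N) → EuclideanSpace ℝ (Fin N) → ℝ) (s : ℝ) : ℝ≥0∞ :=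
  ∫⁻ x, ∫⁻ y, ENNReal.ofReal (f x y / ‖x - y‖ ^ ((N : ℝ) + 2 * s))

section kernelIntegral

variable {N : ℕ} {f g : EuclideanSpace ℝ (Fin N) → EuclideanSpace ℝ (Fin N) → ℝ} {s : ℝ}

theorem measurable_kernelIntegral (hf : Measurable (Function.uncurry f)) :
    Measurable (kernelIntegral N f) := by
  unfold kernelIntegral
  refine Measurable.lintegral_prod_right' (f := fun p : ℝ × EuclideanSpace ℝ (Fin N) =>
    ∫⁻ y, ENNReal.ofReal (f p.2 y / ‖p.2 - y‖ ^ ((N : ℝ) + 2 * p.1))) ?_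
  refine Measurable.lintegral_prod_right'
    (f := fun p : (ℝ × EuclideanSpace ℝ (Fin N)) × EuclideanSpace ℝ (Fin N) =>
    ENNReal.ofReal (f p.1.2 p.2 / ‖p.1.2 - p.2‖ ^ ((N : ℝ) + 2 * p.1.1))) ?_
  have h : Measurable fun p : (ℝ × EuclideanSpace ℝ (Fin N)) × EuclideanSpace ℝ (Fin N) =>
      f p.1.2 p.2 := hf.comp (by fun_prop : Measurable fun p : (ℝ × EuclideanSpace ℝ (Fin N)) ×
        EuclideanSpace ℝ (Fin N) => (p.1.2, p.2))
  fun_prop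

theorem measurable_kernelIntegrand (hf : Measurable (Function.uncurry f)) :
    Measurable fun p : EuclideanSpace ℝ (Fin N) × EuclideanSpace ℝ (Fin N) =>
      ENNReal.ofReal (f p.1 p.2 / ‖p.1 - p.2‖ ^ ((N : ℝ) + 2 * s)) := by
  have h : Measurable fun p : EuclideanSpace ℝ (Fin N) × EuclideanSpace ℝ (Fin N) =>
      f p.1 p.2 := hf
  fun_prop

theorem kernelIntegral_mono (h : ∀ x y, f x y ≤ g x y) :
    kernelIntegral N f s ≤ kernelIntegral N g s := by
  refine lintegral_mono fun x => lintegral_mono fun y => ENNReal.ofReal_le_ofReal ?_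
  have := h x y
  gcongr

theorem kernelIntegral_add (hf : Measurable (Function.uncurry f)) (hf0 : ∀ x y, 0 ≤ f x y)
    (hg0 : ∀ x y, 0 ≤ g x y) :
    kernelIntegral N (fun x y => f x y + g x y) s
      = kernelIntegral N f s + kernelIntegral N g s := by
  have hm := measurable_kernelIntegrand (s := s) hf
  unfold kernelIntegral
  rw [← lintegral_add_left hm.lintegral_prod_right']
  refine lintegral_congr fun x => ?_
  have hmx : Measurable fun y => ENNReal.ofReal (f x y / ‖x - y‖ ^ ((N : ℝ) + 2 * s)) :=
    hm.comp measurable_prodMk_left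
  rw [← lintegral_add_left hmx]
  refine lintegral_congr fun y => ?_
  have hd : 0 ≤ ‖x - y‖ ^ ((N : ℝ) + 2 * s) := by positivity
  rw [add_div, ENNReal.ofReal_add (div_nonneg (hf0 x y) hd) (div_nonneg (hg0 x y) hd)]

theorem kernelIntegral_const_mul {c : ℝ} (hc : 0 ≤ c) :
    kernelIntegral N (fun x y => c * f x y) s = ENNReal.ofReal c * kernelIntegral N f s := by
  unfold kernelIntegral
  rw [← lintegral_const_mul' _ _ ENNReal.ofReal_ne_top]
  refine lintegral_congr fun x => ?_
  rw [← lintegral_const_mul' _ _ ENNReal.ofReal_ne_top]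
  refine lintegral_congr fun y => ?_
  rw [mul_div_assoc, ENNReal.ofReal_mul hc]

theorem kernelIntegral_mul_pos {u v : EuclideanSpace ℝ (Fin N) → ℝ} (hu : Continuous u)
    (hv : Continuous v) (hu0 : ∀ x, 0 ≤ u x) (hv0 : ∀ x, 0 ≤ v x) (hune : u ≠ 0) (hvne : v ≠ 0)
    (huv : ∀ x, u x * v x = 0) : 0 < kernelIntegral N (fun x y => u x * v y) s := by
  have hm : Measurable (Function.uncurry fun x y => u x * v y) :=
    ((hu.comp continuous_fst).mul (hv.comp continuous_snd)).measurable
  have hk := measurable_kernelIntegrand (s := s) hm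
  obtain ⟨a, ha⟩ := Function.ne_iff.1 hune
  obtain ⟨b, hb⟩ := Function.ne_iff.1 hvne
  unfold kernelIntegral
  rw [lintegral_pos_iff_support hk.lintegral_prod_right']
  refine (hu.isOpen_support.measure_pos volume ⟨a, ha⟩).trans_le (measure_mono fun x hx => ?_)
  refine ne_of_gt ((lintegral_pos_iff_support (hk.comp measurable_prodMk_left)).2 ?_)
  refine (hv.isOpen_support.measure_pos volume ⟨b, hb⟩).trans_le (measure_mono fun y hy => ?_)
  have hxy : x ≠ y := by
    rintro rfl
    exact mul_ne_zero hx hy (huv x)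
  have hux : 0 < u x := (hu0 x).lt_of_ne' hx
  have hvy : 0 < v y := (hv0 y).lt_of_ne' hy
  have hd : 0 < ‖x - y‖ := norm_pos_iff.2 (sub_ne_zero.2 hxy)
  exact ne_of_gt (ENNReal.ofReal_pos.2 (by positivity))

end kernelIntegral

theorem measurable_realGamma : Measurable Real.Gamma := by
  have h : Measurable Complex.Gamma := by
    simpa [Pi.inv_def] using Complex.differentiable_one_div_Gamma.continuous.measurable.inv
  exact Complex.measurable_re.comp (h.comp Complex.measurable_ofReal)

theorem measurable_cNs (N : ℕ) : Measurable (cNs N) := by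
  have h1 : Measurable fun s : ℝ => Real.Gamma ((N + 2 * s) / 2) :=
    measurable_realGamma.comp (by fun_prop)
  have h2 : Measurable fun s : ℝ => Real.Gamma (2 - s) := measurable_realGamma.comp (by fun_prop)
  unfold cNs
  fun_prop

theorem cNs_pos (N : ℕ) {s : ℝ} (hs : s ∈ Set.Ioo (0 : ℝ) 1) : 0 < cNs N s := by
  have h0 := hs.1
  have h1 : 0 < 1 - s := sub_pos.2 hs.2
  have h2 : 0 < Real.Gamma ((N + 2 * s) / 2) := Real.Gamma_pos_of_pos (by positivity)
  have h3 : 0 < Real.Gamma (2 - s) := Real.Gamma_pos_of_pos (by linarith)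
  unfold cNs
  positivity

theorem gagSq_zero (N : ℕ) (u : EuclideanSpace ℝ (Fin N) → ℝ) :
    gagSq N u 0 = ∫⁻ x, ENNReal.ofReal (u x ^ 2) := if_pos rfl

theorem gagSq_of_ne_zero {N : ℕ} {u : EuclideanSpace ℝ (Fin N) → ℝ} {s : ℝ} (hs : s ≠ 0) :
    gagSq N u s = ENNReal.ofReal (cNs N s) * kernelIntegral N (fun x y => (u x - u y) ^ 2) s :=
  if_neg hs

/-- The mixed term appearing in the seminorm of a difference of two functions with disjoint
supports. -/
noncomputable def crossTerm (N : ℕ) (u v : EuclideanSpace ℝ (Fin N) → ℝ) (s : ℝ) : ℝ≥0∞ :=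
  ENNReal.ofReal (cNs N s) * kernelIntegral N (fun x y => u x * v y) s

section

variable {N : ℕ} {u v : EuclideanSpace ℝ (Fin N) → ℝ}

theorem measurable_uncurry_sub_sq (hu : Continuous u) :
    Measurable (Function.uncurry fun x y => (u x - u y) ^ 2) :=
  (((hu.comp continuous_fst).sub (hu.comp continuous_snd)).pow 2).measurable

theorem measurable_gagSq (hu : Continuous u) : Measurable (gagSq N u) :=
  Measurable.ite (measurableSet_singleton (0 : ℝ)) measurable_const
    ((measurable_cNs N).ennreal_ofReal.mul
      (measurable_kernelIntegral (measurable_uncurry_sub_sq hu)))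

theorem measurable_crossTerm (hu : Continuous u) (hv : Continuous v) :
    Measurable (crossTerm N u v) :=
  (measurable_cNs N).ennreal_ofReal.mul (measurable_kernelIntegral
    ((hu.comp continuous_fst).mul (hv.comp continuous_snd)).measurable)

theorem gagSq_sub_le (hu : Continuous u) (b s : ℝ) :
    gagSq N (fun x => u x - b * v x) s
      ≤ ENNReal.ofReal 2 * gagSq N u s + ENNReal.ofReal (2 * b ^ 2) * gagSq N v s := by
  have h2b : (0 : ℝ) ≤ 2 * b ^ 2 := by positivity
  by_cases hs : s = 0
  · subst hs
    have hm : Measurable fun x => ENNReal.ofReal 2 * ENNReal.ofReal (u x ^ 2) :=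
      (hu.pow 2).measurable.ennreal_ofReal.const_mul _
    rw [gagSq_zero, gagSq_zero, gagSq_zero, ← lintegral_const_mul' _ _ ENNReal.ofReal_ne_top,
      ← lintegral_const_mul' _ _ ENNReal.ofReal_ne_top,
      ← lintegral_add_left hm]
    refine lintegral_mono fun x => ?_
    rw [← ENNReal.ofReal_mul two_pos.le, ← ENNReal.ofReal_mul h2b,
      ← ENNReal.ofReal_add (by positivity) (by positivity)]
    exact ENNReal.ofReal_le_ofReal (by nlinarith [sq_nonneg (u x + b * v x)])
  · rw [gagSq_of_ne_zero hs, gagSq_of_ne_zero hs, gagSq_of_ne_zero hs, mul_left_comm,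
      mul_left_comm (ENNReal.ofReal (2 * b ^ 2)), ← mul_add,
      ← kernelIntegral_const_mul two_pos.le, ← kernelIntegral_const_mul h2b,
      ← kernelIntegral_add ((measurable_uncurry_sub_sq hu).const_mul 2)
        (fun x y => by positivity) (fun x y => by positivity)]
    gcongr
    exact kernelIntegral_mono fun x y => by
      nlinarith [sq_nonneg ((u x - u y) + b * (v x - v y))]

theorem le_gagSq_sub (hu : Continuous u) (hu0 : ∀ x, 0 ≤ u x)
    (hv0 : ∀ x, 0 ≤ v x) (huv : ∀ x, u x * v x = 0) {b : ℝ} (hb : 0 ≤ b) (s : ℝ) :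
    gagSq N u s + ENNReal.ofReal (2 * b) * crossTerm N u v s
      ≤ gagSq N (fun x => u x - b * v x) s := by
  by_cases hs : s = 0
  · subst hs
    have h0 : crossTerm N u v 0 = 0 := by simp [crossTerm, cNs]
    rw [h0, mul_zero, add_zero, gagSq_zero, gagSq_zero]
    refine lintegral_mono fun x => ENNReal.ofReal_le_ofReal ?_
    nlinarith [huv x, sq_nonneg (b * v x)]
  · rw [gagSq_of_ne_zero hs, gagSq_of_ne_zero hs, crossTerm, mul_left_comm, ← mul_add,
      ← kernelIntegral_const_mul (by positivity),
      ← kernelIntegral_add (measurable_uncurry_sub_sq hu) (fun x y => by positivity)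
        (fun x y => mul_nonneg (by positivity) (mul_nonneg (hu0 x) (hv0 y)))]
    gcongr
    refine kernelIntegral_mono fun x y => ?_
    have h : 0 ≤ b * (u y * v x) := mul_nonneg hb (mul_nonneg (hu0 y) (hv0 x))
    have hx : b * (u x * v x) = 0 := by rw [huv x, mul_zero]
    have hy : b * (u y * v y) = 0 := by rw [huv y, mul_zero]
    nlinarith [sq_nonneg (b * (v x - v y))]

theorem denom_sub_lt_top (hu : Continuous u) {μm : Measure ℝ} (b : ℝ)
    (hDu : denom N μm u < ⊤) (hDv : denom N μm v < ⊤) :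
    denom N μm (fun x => u x - b * v x) < ⊤ := by
  calc denom N μm (fun x => u x - b * v x)
      ≤ ∫⁻ s in Set.Ico (0 : ℝ) 1, (ENNReal.ofReal 2 * gagSq N u s
          + ENNReal.ofReal (2 * b ^ 2) * gagSq N v s) ∂μm :=
        lintegral_mono fun s => gagSq_sub_le hu b s
    _ = ENNReal.ofReal 2 * denom N μm u + ENNReal.ofReal (2 * b ^ 2) * denom N μm v := by
        rw [lintegral_add_left ((measurable_gagSq hu).const_mul _),
          lintegral_const_mul' _ _ ENNReal.ofReal_ne_top,
          lintegral_const_mul' _ _ ENNReal.ofReal_ne_top]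
        rfl
    _ < ⊤ := by finiteness

theorem le_denom_sub (hu : Continuous u) (hu0 : ∀ x, 0 ≤ u x)
    (hv0 : ∀ x, 0 ≤ v x) (huv : ∀ x, u x * v x = 0) (μm : Measure ℝ) {b : ℝ} (hb : 0 ≤ b) :
    denom N μm u + ENNReal.ofReal (2 * b) * ∫⁻ s in Set.Ico (0 : ℝ) 1, crossTerm N u v s ∂μm
      ≤ denom N μm (fun x => u x - b * v x) := by
  rw [denom, ← lintegral_const_mul' _ _ ENNReal.ofReal_ne_top,
    ← lintegral_add_left (measurable_gagSq hu)]
  exact lintegral_mono fun s => le_gagSq_sub hu hu0 hv0 huv hb s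

theorem lintegral_crossTerm_pos (hu : Continuous u) (hv : Continuous v) (hu0 : ∀ x, 0 ≤ u x)
    (hv0 : ∀ x, 0 ≤ v x) (hune : u ≠ 0) (hvne : v ≠ 0) (huv : ∀ x, u x * v x = 0)
    {μm : Measure ℝ} (hμ : 0 < μm (Set.Ioo 0 1)) :
    0 < ∫⁻ s in Set.Ico (0 : ℝ) 1, crossTerm N u v s ∂μm := by
  rw [setLIntegral_pos_iff (measurable_crossTerm hu hv)]
  refine hμ.trans_le (measure_mono fun s hs => ⟨?_, Set.Ioo_subset_Ico_self hs⟩)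
  exact (ENNReal.mul_pos (ENNReal.ofReal_pos.2 (cNs_pos N hs)).ne'
    (kernelIntegral_mul_pos hu hv hu0 hv0 hune hvne huv).ne').ne'

theorem setIntegral_norm_fderiv_sq_pos (hN : 1 ≤ N) {U : Set (EuclideanSpace ℝ (Fin N))}
    (hU : IsOpen U) (hUb : Bornology.IsBounded U) (hUc : IsConnected U) (hu : memA N U u)
    (hint : IntegrableOn (fun x => ‖fderiv ℝ u x‖ ^ 2) U volume) (hune : u ≠ 0) :
    0 < ∫ x in U, ‖fderiv ℝ u x‖ ^ 2 := by
  obtain ⟨hcont, hdiff, hzero⟩ := hu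
  have hnn : ∀ x, 0 ≤ ‖fderiv ℝ u x‖ ^ 2 := fun x => by positivity
  refine (integral_nonneg hnn).lt_of_ne' fun h0 => hune ?_
  rw [integral_eq_zero_iff_of_nonneg hnn hint] at h0
  have hfd : ContinuousOn (fderiv ℝ u) U := hdiff.continuousOn_fderiv_of_isOpen hU le_rfl
  have heq := Measure.eqOn_open_of_ae_eq h0 hU (hfd.norm.pow 2) continuousOn_const
  obtain ⟨c, hc⟩ := hU.exists_is_const_of_fderiv_eq_zero hUc.isPreconnected
    (hdiff.differentiableOn one_ne_zero) (fun x hx => by simpa using heq hx)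
  have : Nonempty (Fin N) := ⟨⟨0, hN⟩⟩
  have hne : U ≠ Set.univ := by
    rintro rfl
    exact NormedSpace.unbounded_univ ℝ (EuclideanSpace ℝ (Fin N)) hUb
  obtain ⟨z, hz⟩ := nonempty_frontier_iff.2 ⟨hUc.nonempty, hne⟩
  have hzc : u z = c := closure_minimal (t := {x | u x = c}) hc
    (isClosed_eq hcont continuous_const) (frontier_subset_closure hz)
  have hz0 : u z = 0 := hzero z fun hzU => (hU.frontier_eq ▸ hz).2 hzU
  ext x
  by_cases hx : x ∈ U
  · rw [hc x hx, ← hzc, hz0, Pi.zero_apply]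
  · exact hzero x hx

theorem lam_le_rayleigh {μm : Measure ℝ} {U : Set (EuclideanSpace ℝ (Fin N))}
    (hu : admissible N μm U u) : lam N μm U ≤ rayleigh N μm U u := by
  refine csInf_le ⟨0, ?_⟩ ⟨u, hu, rfl⟩
  rintro _ ⟨w, -, rfl⟩
  exact div_nonneg (integral_nonneg fun x => by positivity) ENNReal.toReal_nonneg

theorem lam_union_lt_rayleigh (hN : 1 ≤ N) {U V : Set (EuclideanSpace ℝ (Fin N))}
    (hU : IsOpen U) (hV : IsOpen V) (hUb : Bornology.IsBounded U) (hUc : IsConnected U)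
    (hUV : Disjoint U V) {μm : Measure ℝ} (hμ : 0 < μm (Set.Ioo 0 1))
    (hu : admissible N μm U u) (hv : admissible N μm V v)
    (hu0 : ∀ x, 0 ≤ u x) (hv0 : ∀ x, 0 ≤ v x) (hune : u ≠ 0) (hvne : v ≠ 0) :
    lam N μm (U ∪ V) < rayleigh N μm U u := by
  have hEu := setIntegral_norm_fderiv_sq_pos hN hU hUb hUc hu.1 hu.2.1 hune
  obtain ⟨⟨hucont, hudiff, huzero⟩, huint, hDu0, hDu⟩ := hu
  obtain ⟨⟨hvcont, hvdiff, hvzero⟩, hvint, hDv0, hDv⟩ := hv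
  have hvU : ∀ x ∈ U, v x = 0 := fun x hx => hvzero x (Set.disjoint_left.1 hUV hx)
  have huV : ∀ x ∈ V, u x = 0 := fun x hx => huzero x (Set.disjoint_right.1 hUV hx)
  have huv : ∀ x, u x * v x = 0 := fun x => by
    by_cases hx : x ∈ U
    · rw [hvU x hx, mul_zero]
    · rw [huzero x hx, zero_mul]
  set C := ∫⁻ s in Set.Ico (0 : ℝ) 1, crossTerm N u v s ∂μm with hC
  have hC0 : 0 < C := lintegral_crossTerm_pos hucont hvcont hu0 hv0 hune hvne huv hμ
  have hCtop : C < ⊤ := by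
    have h := (le_add_left le_rfl).trans_lt ((le_denom_sub hucont hu0 hv0 huv μm
      (b := 1 / 2) (by norm_num)).trans_lt (denom_sub_lt_top hucont _ hDu hDv))
    simpa using h
  set Eu := ∫ x in U, ‖fderiv ℝ u x‖ ^ 2
  set Ev := ∫ x in V, ‖fderiv ℝ v x‖ ^ 2
  have hEv : 0 ≤ Ev := integral_nonneg fun x => by positivity
  have hCr : 0 < C.toReal := ENNReal.toReal_pos hC0.ne' hCtop.ne
  have hDur : 0 < (denom N μm u).toReal := ENNReal.toReal_pos hDu0.ne' hDu.ne
  set r := rayleigh N μm U u with hr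
  have hrD : r * (denom N μm u).toReal = Eu := div_mul_cancel₀ _ hDur.ne'
  have hr0 : 0 < r := div_pos hEu hDur
  set b := r * C.toReal / (Ev + 1) with hbdef
  have hb0 : 0 < b := by positivity
  have hbE : b * (Ev + 1) = r * C.toReal := div_mul_cancel₀ _ (by positivity)
  set w : EuclideanSpace ℝ (Fin N) → ℝ := fun x => u x - b * v x with hw
  have hlow : denom N μm u + ENNReal.ofReal (2 * b) * C ≤ denom N μm w :=
    le_denom_sub hucont hu0 hv0 huv μm hb0.le
  have hDw : denom N μm w < ⊤ := denom_sub_lt_top hucont b hDu hDv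
  have hDw0 : 0 < denom N μm w := hDu0.trans_le ((le_add_right le_rfl).trans hlow)
  have hlowr : (denom N μm u).toReal + 2 * b * C.toReal ≤ (denom N μm w).toReal := by
    have h := ENNReal.toReal_mono hDw.ne hlow
    rwa [ENNReal.toReal_add hDu.ne (by finiteness), ENNReal.toReal_mul,
      ENNReal.toReal_ofReal (by positivity)] at h
  have hwU : Set.EqOn w u U := fun x hx => by simp [hw, hvU x hx]
  have hwV : Set.EqOn w (fun x => -b * v x) V := fun x hx => by simp [hw, huV x hx]
  have hfU : Set.EqOn (fun x => ‖fderiv ℝ w x‖ ^ 2) (fun x => ‖fderiv ℝ u x‖ ^ 2) U :=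
    fun x hx => by
      simp only [(hwU.eventuallyEq_of_mem (hU.mem_nhds hx)).fderiv_eq]
  have hfV : Set.EqOn (fun x => ‖fderiv ℝ w x‖ ^ 2) (fun x => b ^ 2 * ‖fderiv ℝ v x‖ ^ 2) V :=
    fun x hx => by
      have hd : DifferentiableAt ℝ v x :=
        (hvdiff.differentiableOn one_ne_zero).differentiableAt (hV.mem_nhds hx)
      simp only [(hwV.eventuallyEq_of_mem (hV.mem_nhds hx)).fderiv_eq]
      rw [fderiv_const_mul hd, norm_smul, mul_pow, Real.norm_eq_abs, sq_abs, neg_sq]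
  have hiU : IntegrableOn (fun x => ‖fderiv ℝ w x‖ ^ 2) U volume :=
    huint.congr_fun hfU.symm hU.measurableSet
  have hiV : IntegrableOn (fun x => ‖fderiv ℝ w x‖ ^ 2) V volume :=
    IntegrableOn.congr_fun (hvint.const_mul (b ^ 2)) hfV.symm hV.measurableSet
  have hEw : ∫ x in U ∪ V, ‖fderiv ℝ w x‖ ^ 2 = Eu + b ^ 2 * Ev := by
    rw [setIntegral_union hUV hV.measurableSet hiU hiV, setIntegral_congr_fun hU.measurableSet hfU,
      setIntegral_congr_fun hV.measurableSet hfV, integral_const_mul]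
  have hwdiff : ContDiffOn ℝ 1 w (U ∪ V) :=
    (hudiff.congr hwU).union_of_isOpen ((contDiffOn_const.mul hvdiff).congr hwV) hU hV
  have hadm : admissible N μm (U ∪ V) w := by
    refine ⟨⟨hucont.sub (continuous_const.mul hvcont), hwdiff, fun x hx => ?_⟩,
      hiU.union hiV, hDw0, hDw⟩
    simp [hw, huzero x fun h => hx (Or.inl h), hvzero x fun h => hx (Or.inr h)]
  refine (lam_le_rayleigh hadm).trans_lt ?_
  rw [rayleigh, hEw, div_lt_iff₀ (ENNReal.toReal_pos hDw0.ne' hDw.ne)]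
  have hb2 : b * (b * (Ev + 1)) = b * (r * C.toReal) := by rw [hbE]
  have hpos : 0 < b * (r * C.toReal) := by positivity
  nlinarith [mul_le_mul_of_nonneg_left hlowr hr0.le, sq_nonneg b]

end

theorem stmt2 (N : ℕ) (hN : 1 ≤ N) (Ω₁ Ω₂ : Set (EuclideanSpace ℝ (Fin N)))
    (h1o : IsOpen Ω₁) (h2o : IsOpen Ω₂) (h1b : Bornology.IsBounded Ω₁)
    (h2b : Bornology.IsBounded Ω₂) (h1c : IsConnected Ω₁) (h2c : IsConnected Ω₂)
    (hdisj : Disjoint (closure Ω₁) (closure Ω₂))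
    (μm : Measure ℝ) [IsFiniteMeasure μm] (hμmsupp : μm (Set.Icc 0 1)ᶜ = 0)
    (hμmpos : 0 < μm (Set.Ioo 0 1))
    (u₁ u₂ : EuclideanSpace ℝ (Fin N) → ℝ)
    (h1adm : admissible N μm Ω₁ u₁) (h2adm : admissible N μm Ω₂ u₂)
    (h1nn : ∀ x, 0 ≤ u₁ x) (h2nn : ∀ x, 0 ≤ u₂ x)
    (h1ne : u₁ ≠ 0) (h2ne : u₂ ≠ 0)
    (h1min : rayleigh N μm Ω₁ u₁ = lam N μm Ω₁)
    (h2min : rayleigh N μm Ω₂ u₂ = lam N μm Ω₂) :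
    lam N μm (Ω₁ ∪ Ω₂) < min (lam N μm Ω₁) (lam N μm Ω₂) := by
  have hd : Disjoint Ω₁ Ω₂ := hdisj.mono subset_closure subset_closure
  rw [← h1min, ← h2min]
  refine lt_min
    (lam_union_lt_rayleigh hN h1o h2o h1b h1c hd hμmpos h1adm h2adm h1nn h2nn h1ne h2ne) ?_
  rw [Set.union_comm]
  exact lam_union_lt_rayleigh hN h2o h1o h2b h2c hd.symm hμmpos h2adm h1adm h2nn h1nn h2ne h1ne
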